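/- For every integer n ≥ 1 there exists a finite strictly subcubic class two graph G that consists entirely of a single cluster containing exactly n minimal conflicting subgraphs, where for n ≥ 2 consecutive minimal conflicting subgraphs M_i and M_{i+1} share an edge for each i ∈ {1,…,n−1}. -/

import Mathlib

open SimpleGraph

variable {V : Type*}

/-- Two edges (of a graph) are adjacent if they are distinct and share a vertex. -/
def EdgesAdj (e₁ e₂ : Sym2 V) : Prop := e₁ ≠ e₂ ∧ ∃ v, v ∈ e₁ ∧ v ∈ e₂

/-- `f` is a proper edge colouring of `G`: adjacent edges of `G` get distinct colours. -/
def IsProperEC (G : SimpleGraph V) {α : Type*} (f : Sym2 V → α) : Prop :=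
  ∀ e₁ ∈ G.edgeSet, ∀ e₂ ∈ G.edgeSet, EdgesAdj e₁ e₂ → f e₁ ≠ f e₂

/-- `G` is 3-edge-colourable. -/
def ThreeEC (G : SimpleGraph V) : Prop := ∃ f : Sym2 V → Fin 3, IsProperEC G f

/-- The degree of a vertex. -/
noncomputable def deg (G : SimpleGraph V) (v : V) : ℕ := Nat.card (G.neighborSet v)

/-- Every vertex has degree at most 3. -/
def Subcubic (G : SimpleGraph V) : Prop := ∀ v, deg G v ≤ 3

/-- Every vertex has degree exactly 3. -/
def CubicGraph (G : SimpleGraph V) : Prop := ∀ v, deg G v = 3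

/-- The resistance of `G`: the minimum number of edges whose removal from `G`
yields a 3-edge-colourable graph. -/
noncomputable def resistance (G : SimpleGraph V) : ℕ :=
  sInf {n | ∃ R : Set (Sym2 V), R.ncard = n ∧ ThreeEC (G.deleteEdges R)}

/-- `M` is a minimal conflicting subgraph of `G`: a subgraph of `G` that is not
3-edge-colourable, but `M − e` is 3-edge-colourable for every edge `e` of `M`. -/
def MinConfl (G M : SimpleGraph V) : Prop :=
  M ≤ G ∧ ¬ ThreeEC M ∧ ∀ e ∈ M.edgeSet, ThreeEC (M.deleteEdges {e})

/-- `R` is a representative conflicting subset of `G`: a set of edges of `G`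
containing at least one edge from every minimal conflicting subgraph of `G`. -/
def RepConfl (G : SimpleGraph V) (R : Set (Sym2 V)) : Prop :=
  R ⊆ G.edgeSet ∧ ∀ M : SimpleGraph V, MinConfl G M → (R ∩ M.edgeSet).Nonempty

/-- A minimal colouring of `G`: a proper 4-edge-colouring (colour `0` playing the role
of the fourth colour) in which exactly `resistance G` edges of `G` receive colour `0`. -/
def IsMinimalColoring (G : SimpleGraph V) (f : Sym2 V → Fin 4) : Prop :=
  IsProperEC G f ∧ {e | e ∈ G.edgeSet ∧ f e = 0}.ncard = resistance G

namespace ChainConflict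

/-- Index of an edge of the eight-vertex gadget `Q` (the Petersen graph minus two adjacent
vertices); `10` means that the pair is not an edge of `Q`. Vertex `8` is the connector. -/
def eidxAux : ℕ → ℕ → ℕ
  | 0, 1 => 0
  | 1, 2 => 1
  | 0, 5 => 2
  | 1, 6 => 3
  | 2, 7 => 4
  | 3, 5 => 5
  | 5, 7 => 6
  | 4, 7 => 7
  | 4, 6 => 8
  | 3, 6 => 9
  | _, _ => 10

def eidx (a b : Fin 9) : ℕ := min (eidxAux a b) (eidxAux b a)

/-- Edges of `Q`. -/
abbrev QE (a b : Fin 9) : Prop := eidx a b < 10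

/-- The edge from `Q` to the connector of the same block. -/
abbrev WE (a b : Fin 9) : Prop := (a = 3 ∧ b = 8) ∨ (a = 8 ∧ b = 3)

/-- Edges from a block to the next one. -/
abbrev XE (a b : Fin 9) : Prop := (a = 4 ∧ b = 2) ∨ (a = 0 ∧ b = 8)

theorem eidx_comm (a b : Fin 9) : eidx a b = eidx b a := min_comm _ _

theorem QE_symm {a b : Fin 9} (h : QE a b) : QE b a := by
  unfold QE at *; rwa [eidx_comm]

theorem WE_symm {a b : Fin 9} (h : WE a b) : WE b a := by
  unfold WE at *; tauto

theorem QE_irrefl (a : Fin 9) : ¬ QE a a := by revert a; decide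

theorem WE_irrefl (a : Fin 9) : ¬ WE a a := by revert a; decide

/-- The chain graph. -/
def chainG (n : ℕ) : SimpleGraph (Fin (n + 1) × Fin 9) where
  Adj u v := (u.1.val = v.1.val ∧ (QE u.2 v.2 ∨ WE u.2 v.2)) ∨
    (u.1.val + 1 = v.1.val ∧ XE u.2 v.2) ∨ (v.1.val + 1 = u.1.val ∧ XE v.2 u.2)
  symm := ⟨by
    rintro u v (⟨h, h' | h'⟩ | h | h)
    · exact Or.inl ⟨h.symm, Or.inl (QE_symm h')⟩
    · exact Or.inl ⟨h.symm, Or.inr (WE_symm h')⟩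
    · exact Or.inr (Or.inr h)
    · exact Or.inr (Or.inl h)⟩
  loopless := ⟨by
    rintro u (⟨-, h | h⟩ | h | h)
    · exact QE_irrefl _ h
    · exact WE_irrefl _ h
    · omega
    · omega⟩

/-- The `k`-th minimal conflicting subgraph. -/
def ringM (n k : ℕ) : SimpleGraph (Fin (n + 1) × Fin 9) where
  Adj u v := (u.1.val = v.1.val ∧ ((QE u.2 v.2 ∧ (u.1.val = k ∨ u.1.val = k + 1)) ∨
      (WE u.2 v.2 ∧ u.1.val = k + 1))) ∨
    (u.1.val = k ∧ v.1.val = k + 1 ∧ XE u.2 v.2) ∨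
    (v.1.val = k ∧ u.1.val = k + 1 ∧ XE v.2 u.2)
  symm := ⟨by
    rintro u v (⟨h, ⟨h', h''⟩ | ⟨h', h''⟩⟩ | h | h)
    · exact Or.inl ⟨h.symm, Or.inl ⟨QE_symm h', h ▸ h''⟩⟩
    · exact Or.inl ⟨h.symm, Or.inr ⟨WE_symm h', h ▸ h''⟩⟩
    · exact Or.inr (Or.inr h)
    · exact Or.inr (Or.inl h)⟩
  loopless := ⟨by
    rintro u (⟨-, ⟨h, -⟩ | ⟨h, -⟩⟩ | h | h)
    · exact QE_irrefl _ h
    · exact WE_irrefl _ h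
    · omega
    · omega⟩

theorem ringM_le (n k : ℕ) : ringM n k ≤ chainG n := by
  rintro u v (⟨h, ⟨h', h''⟩ | ⟨h', h''⟩⟩ | ⟨h, h', h''⟩ | ⟨h, h', h''⟩)
  · exact Or.inl ⟨h, Or.inl h'⟩
  · exact Or.inl ⟨h, Or.inr h'⟩
  · exact Or.inr (Or.inl ⟨by omega, h''⟩)
  · exact Or.inr (Or.inr ⟨by omega, h''⟩)

theorem ringM_index {n k l : ℕ} (hk : k < n) (h : ringM n k ≤ ringM n l) : k = l := by
  have h1 : (ringM n k).Adj (⟨k, by omega⟩, 4) (⟨k + 1, by omega⟩, 2) :=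
    Or.inr (Or.inl ⟨rfl, rfl, Or.inl ⟨rfl, rfl⟩⟩)
  rcases h h1 with ⟨h, -⟩ | ⟨h, h', h''⟩ | ⟨h, h', h''⟩
  · simp at h
  · exact h
  · simp only at h h'
    omega

/-! ### Colouring criteria -/

theorem threeEC_of {V : Type} {N : SimpleGraph V} (c : V → V → Fin 3)
    (hc : ∀ u v, c u v = c v u)
    (hp : ∀ u v w, N.Adj u v → N.Adj u w → v ≠ w → c u v ≠ c u w) : ThreeEC N := by
  refine ⟨Sym2.lift ⟨c, hc⟩, ?_⟩
  rintro e₁ h₁ e₂ h₂ ⟨hne, u, hu₁, hu₂⟩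
  obtain ⟨v, rfl⟩ := hu₁
  obtain ⟨w, rfl⟩ := hu₂
  exact hp u v w h₁ h₂ (fun h => hne (h ▸ rfl))

theorem threeEC_exists {V : Type} {N : SimpleGraph V} (h : ThreeEC N) :
    ∃ c : V → V → Fin 3, (∀ u v, c u v = c v u) ∧
      (∀ u v w, N.Adj u v → N.Adj u w → v ≠ w → c u v ≠ c u w) := by
  obtain ⟨f, hf⟩ := h
  refine ⟨fun u v => f s(u, v), fun u v => congrArg f Sym2.eq_swap, fun u v w h₁ h₂ hne => ?_⟩
  refine hf _ h₁ _ h₂ ⟨fun h => hne ?_, u, by simp, by simp⟩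
  exact Sym2.congr_right.1 h

theorem threeEC_mono {V : Type} {N N' : SimpleGraph V} (h : ThreeEC N') (hle : N ≤ N') :
    ThreeEC N := by
  obtain ⟨f, hf⟩ := h
  exact ⟨f, fun e₁ h₁ e₂ h₂ =>
    hf e₁ (SimpleGraph.edgeSet_mono hle h₁) e₂ (SimpleGraph.edgeSet_mono hle h₂)⟩

/-! ### The gadget forces equality -/

set_option maxRecDepth 100000 in
set_option synthInstance.maxSize 4096 in
set_option synthInstance.maxHeartbeats 2000000 in
set_option maxHeartbeats 2000000 in
theorem gadget_left : ∀ e0 e2 : Fin 3, e0 ≠ e2 → ∀ e1, e1 ≠ e0 → ∀ e3, e3 ≠ e0 → e3 ≠ e1 →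
    ∀ e5, e5 ≠ e2 → ∀ e6, e6 ≠ e2 → e6 ≠ e5 → ∀ e4, e4 ≠ e1 → e4 ≠ e6 →
    ∀ e7, e7 ≠ e4 → e7 ≠ e6 → ∀ e9, e9 ≠ e3 → e9 ≠ e5 → ∀ e8, e8 ≠ e3 → e8 ≠ e9 → e8 ≠ e7 →
    ∀ x, x ≠ e1 → x ≠ e4 → ∀ y, y ≠ e5 → y ≠ e9 → x = y := by
  decide

set_option maxRecDepth 100000 in
set_option synthInstance.maxSize 4096 in
set_option synthInstance.maxHeartbeats 2000000 in
set_option maxHeartbeats 2000000 in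
theorem gadget_right : ∀ e0 e2 : Fin 3, e0 ≠ e2 → ∀ e1, e1 ≠ e0 → ∀ e3, e3 ≠ e0 → e3 ≠ e1 →
    ∀ e5, e5 ≠ e2 → ∀ e6, e6 ≠ e2 → e6 ≠ e5 → ∀ e4, e4 ≠ e1 → e4 ≠ e6 →
    ∀ e7, e7 ≠ e4 → e7 ≠ e6 → ∀ e9, e9 ≠ e3 → e9 ≠ e5 → ∀ e8, e8 ≠ e3 → e8 ≠ e9 → e8 ≠ e7 →
    ∀ x, x ≠ e0 → x ≠ e2 → ∀ y, y ≠ e7 → y ≠ e8 → x = y := by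
  decide

theorem ringM_not (n k : ℕ) (hk : k < n) : ¬ ThreeEC (ringM n k) := by
  intro h
  obtain ⟨c, hc, hp⟩ := threeEC_exists h
  have hQ : ∀ i : Fin (n + 1), i.val = k ∨ i.val = k + 1 → ∀ a b d, QE a b → QE a d → b ≠ d →
      c (i, a) (i, b) ≠ c (i, a) (i, d) := by
    intro i hi a b d h1 h2 hne
    refine hp _ _ _ (Or.inl ⟨rfl, Or.inl ⟨h1, hi⟩⟩) (Or.inl ⟨rfl, Or.inl ⟨h2, hi⟩⟩) ?_
    simpa using hne
  have hQ' : ∀ i : Fin (n + 1), i.val = k ∨ i.val = k + 1 → ∀ v a b, QE a b →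
      (ringM n k).Adj (i, a) v → v ≠ (i, b) → c (i, a) v ≠ c (i, a) (i, b) := by
    intro i hi v a b h1 h2 hne
    exact hp _ _ _ h2 (Or.inl ⟨rfl, Or.inl ⟨h1, hi⟩⟩) hne
  obtain ⟨i, hi⟩ : ∃ i : Fin (n + 1), i.val = k := ⟨⟨k, by omega⟩, rfl⟩
  obtain ⟨j, hj⟩ : ∃ j : Fin (n + 1), j.val = k + 1 := ⟨⟨k + 1, by omega⟩, rfl⟩
  have hij : i ≠ j := by rintro rfl; omega
  have hx1 : (ringM n k).Adj (i, 4) (j, 2) := Or.inr (Or.inl ⟨hi, hj, Or.inl ⟨rfl, rfl⟩⟩)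
  have hx2 : (ringM n k).Adj (i, 0) (j, 8) := Or.inr (Or.inl ⟨hi, hj, Or.inr ⟨rfl, rfl⟩⟩)
  have hw : (ringM n k).Adj (j, 3) (j, 8) := Or.inl ⟨rfl, Or.inr ⟨Or.inl ⟨rfl, rfl⟩, hj⟩⟩
  have hq : ∀ i : Fin (n + 1), i.val = k ∨ i.val = k + 1 → _ := fun i hi =>
    And.intro (gadget_left (c (i, 0) (i, 1)) (c (i, 0) (i, 5)) (hQ i hi _ _ _ (by decide) (by decide) (by decide))
      (c (i, 1) (i, 2)) (by rw [hc (i, 0) (i, 1)]; exact hQ i hi _ _ _ (by decide) (by decide) (by decide))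
      (c (i, 1) (i, 6)) (by rw [hc (i, 0) (i, 1)]; exact hQ i hi _ _ _ (by decide) (by decide) (by decide))
      (hQ i hi _ _ _ (by decide) (by decide) (by decide))
      (c (i, 5) (i, 3)) (by rw [hc (i, 0) (i, 5)]; exact hQ i hi _ _ _ (by decide) (by decide) (by decide))
      (c (i, 5) (i, 7)) (by rw [hc (i, 0) (i, 5)]; exact hQ i hi _ _ _ (by decide) (by decide) (by decide))
      (hQ i hi _ _ _ (by decide) (by decide) (by decide))
      (c (i, 2) (i, 7)) (by rw [hc (i, 1) (i, 2)]; exact hQ i hi _ _ _ (by decide) (by decide) (by decide))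
      (by rw [hc (i, 2) (i, 7), hc (i, 5) (i, 7)]; exact hQ i hi _ _ _ (by decide) (by decide) (by decide))
      (c (i, 7) (i, 4)) (by rw [hc (i, 2) (i, 7)]; exact hQ i hi _ _ _ (by decide) (by decide) (by decide))
      (by rw [hc (i, 5) (i, 7)]; exact hQ i hi _ _ _ (by decide) (by decide) (by decide))
      (c (i, 6) (i, 3)) (by rw [hc (i, 1) (i, 6)]; exact hQ i hi _ _ _ (by decide) (by decide) (by decide))
      (by rw [hc (i, 6) (i, 3), hc (i, 5) (i, 3)]; exact hQ i hi _ _ _ (by decide) (by decide) (by decide))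
      (c (i, 6) (i, 4)) (by rw [hc (i, 1) (i, 6)]; exact hQ i hi _ _ _ (by decide) (by decide) (by decide))
      (hQ i hi _ _ _ (by decide) (by decide) (by decide))
      (by rw [hc (i, 6) (i, 4), hc (i, 7) (i, 4)]; exact hQ i hi _ _ _ (by decide) (by decide) (by decide)))
     (gadget_right (c (i, 0) (i, 1)) (c (i, 0) (i, 5)) (hQ i hi _ _ _ (by decide) (by decide) (by decide))
      (c (i, 1) (i, 2)) (by rw [hc (i, 0) (i, 1)]; exact hQ i hi _ _ _ (by decide) (by decide) (by decide))
      (c (i, 1) (i, 6)) (by rw [hc (i, 0) (i, 1)]; exact hQ i hi _ _ _ (by decide) (by decide) (by decide))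
      (hQ i hi _ _ _ (by decide) (by decide) (by decide))
      (c (i, 5) (i, 3)) (by rw [hc (i, 0) (i, 5)]; exact hQ i hi _ _ _ (by decide) (by decide) (by decide))
      (c (i, 5) (i, 7)) (by rw [hc (i, 0) (i, 5)]; exact hQ i hi _ _ _ (by decide) (by decide) (by decide))
      (hQ i hi _ _ _ (by decide) (by decide) (by decide))
      (c (i, 2) (i, 7)) (by rw [hc (i, 1) (i, 2)]; exact hQ i hi _ _ _ (by decide) (by decide) (by decide))
      (by rw [hc (i, 2) (i, 7), hc (i, 5) (i, 7)]; exact hQ i hi _ _ _ (by decide) (by decide) (by decide))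
      (c (i, 7) (i, 4)) (by rw [hc (i, 2) (i, 7)]; exact hQ i hi _ _ _ (by decide) (by decide) (by decide))
      (by rw [hc (i, 5) (i, 7)]; exact hQ i hi _ _ _ (by decide) (by decide) (by decide))
      (c (i, 6) (i, 3)) (by rw [hc (i, 1) (i, 6)]; exact hQ i hi _ _ _ (by decide) (by decide) (by decide))
      (by rw [hc (i, 6) (i, 3), hc (i, 5) (i, 3)]; exact hQ i hi _ _ _ (by decide) (by decide) (by decide))
      (c (i, 6) (i, 4)) (by rw [hc (i, 1) (i, 6)]; exact hQ i hi _ _ _ (by decide) (by decide) (by decide))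
      (hQ i hi _ _ _ (by decide) (by decide) (by decide))
      (by rw [hc (i, 6) (i, 4), hc (i, 7) (i, 4)]; exact hQ i hi _ _ _ (by decide) (by decide) (by decide)))
  have hi' : i.val = k ∨ i.val = k + 1 := Or.inl hi
  have hj' : j.val = k ∨ j.val = k + 1 := Or.inr hj
  have e1 : c (i, 0) (j, 8) = c (i, 4) (j, 2) := (hq i hi').2 _
    (hQ' i hi' _ _ _ (by decide) hx2 (by simp))
    (hQ' i hi' _ _ _ (by decide) hx2 (by simp)) _
    (by rw [hc (i, 7) (i, 4)]; exact hQ' i hi' _ _ _ (by decide) hx1 (by simp [hij.symm]))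
    (by rw [hc (i, 6) (i, 4)]; exact hQ' i hi' _ _ _ (by decide) hx1 (by simp [hij.symm]))
  have e2 : c (j, 2) (i, 4) = c (j, 3) (j, 8) := (hq j hj').1 _
    (by rw [hc (j, 1) (j, 2)]; exact hQ' j hj' _ _ _ (by decide) hx1.symm (by simp))
    (hQ' j hj' _ _ _ (by decide) hx1.symm (by simp)) _
    (by rw [hc (j, 5) (j, 3)]; exact hQ' j hj' _ _ _ (by decide) hw (by simp))
    (by rw [hc (j, 6) (j, 3)]; exact hQ' j hj' _ _ _ (by decide) hw (by simp))
  have e3 := hp (j, 8) (i, 0) (j, 3) hx2.symm hw.symm (by simp)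
  apply e3
  rw [hc, e1, hc, e2, hc]

/-! ### Colourings of broken gadgets -/

/-- Colourings of the gadget with edge `k` removed (`k = 10`: nothing removed). Entries `0`–`9`
are colours of the edges, entries `10`–`13` those of the dangling edges at `2, 3, 0, 4`. -/
def colL : ℕ → List (Fin 3)
  | 0 => [0, 0, 1, 2, 1, 2, 0, 2, 0, 1, 2, 0, 0, 1]
  | 1 => [0, 0, 1, 1, 2, 2, 0, 1, 2, 0, 0, 1, 2, 0]
  | 2 => [0, 1, 0, 2, 0, 2, 1, 2, 0, 1, 2, 0, 2, 1]
  | 3 => [0, 1, 1, 0, 2, 2, 0, 1, 2, 0, 0, 1, 2, 0]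
  | 4 => [0, 1, 1, 2, 0, 2, 0, 2, 0, 1, 2, 0, 2, 1]
  | 5 => [0, 1, 2, 2, 0, 0, 1, 2, 1, 0, 2, 1, 1, 0]
  | 6 => [0, 1, 1, 2, 0, 2, 0, 2, 0, 1, 2, 0, 2, 1]
  | 7 => [0, 1, 1, 2, 2, 2, 0, 0, 1, 0, 0, 1, 2, 0]
  | 8 => [0, 1, 1, 2, 2, 2, 0, 1, 0, 0, 0, 1, 2, 0]
  | 9 => [0, 1, 2, 2, 0, 0, 1, 2, 1, 0, 2, 1, 1, 0]
  | _ => [0, 1, 1, 2, 0, 0, 2, 1, 0, 1, 2, 2, 2, 2]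

def col (k m : ℕ) : Fin 3 := (colL k).getD m 0

/-- Index of the dangling edge. -/
def dang (a : Fin 9) : ℕ := if a = 2 then 10 else if a = 3 then 11 else if a = 0 then 12 else 13

set_option maxRecDepth 100000 in
theorem col_proper : ∀ u v : Fin 9, eidx u v < 10 → ∀ w : Fin 9, eidx u w < 10 → v ≠ w →
    ∀ k : Fin 11, eidx u v ≠ k → eidx u w ≠ k → col k (eidx u v) ≠ col k (eidx u w) := by
  decide

set_option maxRecDepth 100000 in
theorem col_dang : ∀ u v : Fin 9, eidx u v < 10 → (u = 2 ∨ u = 3 ∨ u = 0 ∨ u = 4) →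
    ∀ k : Fin 11, eidx u v ≠ k → col k (eidx u v) ≠ col k (dang u) := by
  decide

theorem col_broken : ∀ k : Fin 11, k ≠ 10 →
    col k (dang 2) ≠ col k (dang 3) ∧ col k (dang 0) ≠ col k (dang 4) := by
  decide

theorem perm_exists : ∀ a b x y : Fin 3, (a = b → x = y → False) →
    ∃ σ : Equiv.Perm (Fin 3), b = σ x ∧ a ≠ σ y := by
  decide

theorem perm_exists₁ : ∀ b x : Fin 3, ∃ σ : Equiv.Perm (Fin 3), b = σ x := by
  decide

theorem perm_exists₂ : ∀ a y : Fin 3, ∃ σ : Equiv.Perm (Fin 3), a ≠ σ y := by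
  decide

set_option maxRecDepth 100000 in
theorem eidx_inj : ∀ a b : Fin 9, eidx a b < 10 → ∀ a' b' : Fin 9, eidx a' b' = eidx a b →
    (a' = a ∧ b' = b) ∨ (a' = b ∧ b' = a) := by
  decide

theorem QE_ne_eight : ∀ a b : Fin 9, QE a b → a ≠ 8 ∧ b ≠ 8 := by decide

/-- Block in which the neighbour along the dangling edge lies. -/
def nb (i : ℕ) (a : Fin 9) : ℕ := if a = 3 then i else if a = 2 then i - 1 else i + 1

/-- Position of the neighbour along the dangling edge. -/
def tgt (a : Fin 9) : Fin 9 := if a = 2 then 4 else if a = 4 then 2 else 8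

theorem chain_colour (n : ℕ) (N : SimpleGraph (Fin (n + 1) × Fin 9)) (hN : N ≤ chainG n)
    (hM : ∀ k < n, ¬ ringM n k ≤ N) : ThreeEC N := by
  classical
  -- the missing edge of each block
  have hk : ∀ i : ℕ, ∃ k : Fin 11,
      (∀ h : i < n + 1, ∀ a b, QE a b → N.Adj (⟨i, h⟩, a) (⟨i, h⟩, b) → eidx a b ≠ k) ∧
      (k = 10 → ∀ h : i < n + 1, ∀ a b, QE a b → N.Adj (⟨i, h⟩, a) (⟨i, h⟩, b)) := by
    intro i
    by_cases hex : ∃ h : i < n + 1, ∃ a b, QE a b ∧ ¬ N.Adj (⟨i, h⟩, a) (⟨i, h⟩, b)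
    · obtain ⟨h, a, b, hq, hnot⟩ := hex
      have hq' : eidx a b < 10 := hq
      refine ⟨⟨eidx a b, by omega⟩, ?_, ?_⟩
      · intro _ a' b' _ hadj heq
        rcases eidx_inj a b hq a' b' heq with ⟨rfl, rfl⟩ | ⟨rfl, rfl⟩
        · exact hnot hadj
        · exact hnot hadj.symm
      · intro h10
        have := congrArg Fin.val h10
        simp at this
        omega
    · push Not at hex
      refine ⟨10, fun _ a b hq _ => ?_, fun _ h a b hq => hex h a b hq⟩
      have hq' : eidx a b < 10 := hq
      have h10 : ((10 : Fin 11) : ℕ) = 10 := rfl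
      omega
  choose κ hκ hκ' using hk
  obtain ⟨D, hD⟩ : ∃ D : ℕ → Fin 9 → Fin 3, ∀ i a, D i a = col (κ i) (dang a) :=
    ⟨_, fun _ _ => rfl⟩
  let mid : ℕ → Prop := fun i => ∃ h : i + 1 < n + 1,
    N.Adj (⟨i, by omega⟩, 4) (⟨i + 1, h⟩, 2)
  let wed : ℕ → Prop := fun i => ∃ h : i + 1 < n + 1,
    N.Adj (⟨i, by omega⟩, 0) (⟨i + 1, h⟩, 8) ∧ N.Adj (⟨i + 1, h⟩, 3) (⟨i + 1, h⟩, 8)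
  have hτ : ∀ i : ℕ, ∃ σ : Equiv.Perm (Fin 3), (mid i → D i 4 = σ (D (i + 1) 2)) ∧
      (wed i → D i 0 ≠ σ (D (i + 1) 3)) := by
    intro i
    by_cases h1 : mid i
    · by_cases h2 : wed i
      · obtain ⟨σ, hσ⟩ := perm_exists (D i 0) (D i 4) (D (i + 1) 2) (D (i + 1) 3) (by
          intro e1 e2
          have k1 : κ i = 10 := by
            by_contra hne
            exact (col_broken _ hne).2 (by rw [← hD, ← hD, e1])
          have k2 : κ (i + 1) = 10 := by
            by_contra hne
            exact (col_broken _ hne).1 (by rw [← hD, ← hD, e2])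
          obtain ⟨hi, h1⟩ := h1
          obtain ⟨_, h2, h3⟩ := h2
          refine hM i (by omega) ?_
          have hX : ∀ a b, XE a b → N.Adj (⟨i, by omega⟩, a) (⟨i + 1, hi⟩, b) := by
            rintro a b (⟨rfl, rfl⟩ | ⟨rfl, rfl⟩)
            · exact h1
            · exact h2
          rintro ⟨⟨u, hu⟩, a⟩ ⟨⟨v, hv⟩, b⟩ h
          rcases h with ⟨h, ⟨h', h'' | h''⟩ | ⟨h', h''⟩⟩ | ⟨h, h', h''⟩ | ⟨h, h', h''⟩ <;>
            simp only at h h' h''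
          · subst h; subst h''; exact hκ' _ k1 _ _ _ h'
          · subst h; subst h''; exact hκ' _ k2 _ _ _ h'
          · subst h; subst h''
            rcases h' with ⟨rfl, rfl⟩ | ⟨rfl, rfl⟩
            · exact h3
            · exact h3.symm
          · subst h; subst h'; exact hX _ _ h''
          · subst h; subst h'; exact (hX _ _ h'').symm)
        exact ⟨σ, fun _ => hσ.1, fun _ => hσ.2⟩
      · obtain ⟨σ, hσ⟩ := perm_exists₁ (D i 4) (D (i + 1) 2)
        exact ⟨σ, fun _ => hσ, fun h => absurd h h2⟩
    · obtain ⟨σ, hσ⟩ := perm_exists₂ (D i 0) (D (i + 1) 3)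
      exact ⟨σ, fun h => absurd h h1, fun _ => hσ⟩
  choose τ hτm hτw using hτ
  obtain ⟨σ, hσ⟩ : ∃ σ : ℕ → Equiv.Perm (Fin 3), ∀ i x, σ (i + 1) x = σ i (τ i x) :=
    ⟨fun i => Nat.rec 1 (fun i s => s * τ i) i, fun i x => rfl⟩
  have hm : ∀ i, mid i → σ i (D i 4) = σ (i + 1) (D (i + 1) 2) := by
    intro i h; rw [hσ, ← hτm i h]
  have hw : ∀ i, wed i → σ i (D i 0) ≠ σ (i + 1) (D (i + 1) 3) := by
    intro i h; rw [hσ]; exact fun h' => hτw i h ((σ i).injective h')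
  let c : Fin (n + 1) × Fin 9 → Fin (n + 1) × Fin 9 → Fin 3 := fun u v =>
    if u.1 = v.1 then
      (if u.2 = 8 ∨ v.2 = 8 then σ u.1 (D u.1 3) else σ u.1 (col (κ u.1) (eidx u.2 v.2)))
    else if u.1 < v.1 then
      (if v.2 = 8 then σ u.1 (D u.1 0) else σ u.1 (D u.1 4))
    else
      (if u.2 = 8 then σ v.1 (D v.1 0) else σ v.1 (D v.1 4))
  have hc : ∀ u v, c u v = c v u := by
    rintro ⟨i, a⟩ ⟨j, b⟩
    rcases lt_trichotomy i j with h | h | h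
    · simp only [c, if_neg h.ne, if_neg h.ne', if_pos h, if_neg h.not_gt]
    · subst h
      simp only [c, if_true, or_comm, eidx_comm a b]
    · simp only [c, if_neg h.ne, if_neg h.ne', if_pos h, if_neg h.not_gt]
  have hout : ∀ (i j : Fin (n + 1)) (b a : Fin 9), i.val + 1 = j.val → c (i, a) (j, b) =
      if b = 8 then σ i (D i 0) else σ i (D i 4) := by
    intro i j b a h
    have hlt : i < j := Fin.lt_def.2 (by omega)
    simp only [c, if_neg hlt.ne, if_pos hlt]
  -- classification of the edges at a vertex
  have hcls : ∀ (i : Fin (n + 1)) (a : Fin 9) v, N.Adj (i, a) v →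
      (∃ b, v = (i, b) ∧ QE a b ∧ eidx a b ≠ κ i ∧
        c (i, a) v = σ i (col (κ i) (eidx a b))) ∨
      ((a = 2 ∨ a = 3 ∨ a = 0 ∨ a = 4) ∧ v.1.val = nb i a ∧ v.2 = tgt a ∧
        c (i, a) v = σ i (D i a)) ∨
      (a = 8 ∧ v = (i, 3) ∧ c (i, a) v = σ i (D i 3)) ∨
      (a = 8 ∧ ∃ i' : Fin (n + 1), i'.val + 1 = i.val ∧ v = (i', 0) ∧
        c (i, a) v = σ i' (D i' 0)) := by
    rintro i a ⟨j, b⟩ hadj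
    rcases hN hadj with ⟨h, h' | h'⟩ | ⟨h, h'⟩ | ⟨h, h'⟩ <;> simp only at h h'
    · obtain rfl : i = j := Fin.ext h
      left
      refine ⟨b, rfl, h', hκ i i.2 a b h' hadj, ?_⟩
      obtain ⟨ha, hb⟩ := QE_ne_eight a b h'
      simp [c, ha, hb]
    · obtain rfl : i = j := Fin.ext h
      rcases h' with ⟨rfl, rfl⟩ | ⟨rfl, rfl⟩
      · right; left
        simp [c, nb, tgt]
      · right; right; left
        simp [c]
    · right; left
      rcases h' with ⟨rfl, rfl⟩ | ⟨rfl, rfl⟩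
      · rw [hout _ _ _ _ h]
        simp [nb, tgt, h.symm]
      · rw [hout _ _ _ _ h]
        simp [nb, tgt, h.symm]
    · rcases h' with ⟨rfl, rfl⟩ | ⟨rfl, rfl⟩
      · right; left
        rw [hc, hout _ _ _ _ h]
        refine ⟨Or.inl rfl, ?_, rfl, ?_⟩
        · simp [nb]; omega
        · have : mid j := ⟨by omega, by
            have e : (⟨j.val + 1, by omega⟩ : Fin (n + 1)) = i := Fin.ext h
            rw [e]; exact hadj.symm⟩
          have := hm j this
          rw [h] at this
          simpa using this
      · right; right; right
        refine ⟨rfl, j, h, rfl, ?_⟩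
        rw [hc, hout _ _ _ _ h]
        simp
  have hW : ∀ i i' : Fin (n + 1), i'.val + 1 = i.val → N.Adj (i, 8) (i, 3) →
      N.Adj (i, 8) (i', 0) → σ i' (D i' 0) ≠ σ i (D i 3) := by
    intro i i' h h1 h2
    have : wed i' := ⟨by omega, by
      have e : (⟨i'.val + 1, by omega⟩ : Fin (n + 1)) = i := Fin.ext h
      rw [e]; exact ⟨h2.symm, h1.symm⟩⟩
    have := hw i' this
    rwa [h] at this
  refine threeEC_of c hc ?_
  rintro ⟨i, a⟩ v w h1 h2 hne
  rcases hcls i a v h1 with ⟨b, rfl, hq, hk, e1⟩ | ⟨ha, hv1, hv2, e1⟩ | ⟨rfl, rfl, e1⟩ |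
      ⟨rfl, i', hi', rfl, e1⟩ <;>
    rcases hcls i _ w h2 with ⟨b', rfl, hq', hk', e2⟩ | ⟨ha', hw1, hw2, e2⟩ | ⟨ha', rfl, e2⟩ |
      ⟨ha', i'', hi'', rfl, e2⟩ <;>
    first
    | exact absurd rfl hne
    | rw [e1, e2]
  · exact fun h => col_proper a b hq b' hq' (fun h => hne (h ▸ rfl)) _ hk hk'
      ((σ i).injective h)
  · exact fun h => col_dang a b hq ha' _ hk ((hD i a) ▸ (σ i).injective h)
  · exact absurd ha' (QE_ne_eight _ _ hq).1
  · exact absurd ha' (QE_ne_eight _ _ hq).1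
  · exact fun h => col_dang a b' hq' ha _ hk' ((hD i a) ▸ ((σ i).injective h).symm)
  · exact absurd (Prod.ext (Fin.ext (hv1.trans hw1.symm)) (hv2.trans hw2.symm)) hne
  · subst ha'; exact absurd ha (by decide)
  · subst ha'; exact absurd ha (by decide)
  · exact absurd rfl (QE_ne_eight _ _ hq').1
  · exact absurd ha' (by decide)
  · exact (hW i i'' hi'' h1 h2).symm
  · exact absurd rfl (QE_ne_eight _ _ hq').1
  · exact absurd ha' (by decide)
  · exact hW i i' hi' h2 h1
  · obtain rfl : i' = i'' := Fin.ext (by omega)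
    exact absurd rfl hne

theorem chain_deg (n : ℕ) : Subcubic (chainG n) := by
  rintro ⟨i, a⟩
  let K : Finset (Fin 9) := Finset.univ.filter fun b => QE a b ∨ WE a b ∨ XE a b ∨ XE b a
  have hK : K.card ≤ 3 := by
    revert a; decide
  have hmem : ∀ v : (chainG n).neighborSet (i, a), v.1.2 ∈ K := by
    rintro ⟨⟨j, b⟩, ⟨-, h | h⟩ | ⟨-, h⟩ | ⟨-, h⟩⟩ <;> refine Finset.mem_filter.2 ⟨Finset.mem_univ _, ?_⟩
    · exact Or.inl h
    · exact Or.inr (Or.inl h)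
    · exact Or.inr (Or.inr (Or.inl h))
    · exact Or.inr (Or.inr (Or.inr h))
  have hinj : Function.Injective (fun v : (chainG n).neighborSet (i, a) => (⟨v.1.2, hmem v⟩ : K)) := by
    have key1 : ∀ a b : Fin 9, QE a b ∨ WE a b → ¬ XE a b ∧ ¬ XE b a := by decide
    have key2 : ∀ a b : Fin 9, ¬ (XE a b ∧ XE b a) := by decide
    rintro ⟨⟨j, b⟩, h1⟩ ⟨⟨j', b'⟩, h2⟩ h
    simp only [Subtype.mk.injEq] at h
    subst h
    have : j = j' := by
      have k1 := key1 a b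
      have k2 := key2 a b
      rcases h1 with ⟨h1, h1'⟩ | ⟨h1, h1'⟩ | ⟨h1, h1'⟩ <;>
      rcases h2 with ⟨h2, h2'⟩ | ⟨h2, h2'⟩ | ⟨h2, h2'⟩ <;>
      simp only at h1 h2
      · exact Fin.ext (by omega)
      · exact absurd h2' (k1 h1').1
      · exact absurd h2' (k1 h1').2
      · exact absurd h1' (k1 h2').1
      · exact Fin.ext (by omega)
      · exact absurd ⟨h1', h2'⟩ k2
      · exact absurd h1' (k1 h2').2
      · exact absurd ⟨h2', h1'⟩ k2
      · exact Fin.ext (by omega)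
    subst this
    rfl
  unfold deg
  calc _ ≤ Nat.card K := Nat.card_le_card_of_injective _ hinj
    _ = K.card := by simp
    _ ≤ 3 := hK

theorem chain_deg_lt (n : ℕ) : deg (chainG n) (0, 8) < 3 := by
  have : (chainG n).neighborSet (0, 8) ⊆ {(0, 3)} := by
    have k1 : ∀ b : Fin 9, QE 8 b ∨ WE 8 b → b = 3 := by decide
    have k2 : ∀ b : Fin 9, ¬ XE 8 b := by decide
    rintro ⟨j, b⟩ (⟨h, h'⟩ | ⟨-, h⟩ | ⟨h, -⟩)
    · have hj : j = 0 := Fin.ext h.symm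
      rw [hj, k1 b h']; rfl
    · exact absurd h (k2 b)
    · simp at h
  unfold deg
  have := Nat.card_mono (Set.finite_singleton _) this
  simp only [Nat.card_eq_fintype_card, Fintype.card_unique] at this ⊢
  omega

end ChainConflict

open ChainConflict

/-- For every `n ≥ 1` there is a finite strictly subcubic class two graph consisting of a
single cluster with exactly `n` minimal conflicting subgraphs, consecutive ones sharing
an edge. -/
theorem stmt_13 (n : ℕ) (hn : 1 ≤ n) :
    ∃ (V : Type) (_ : Fintype V) (G : SimpleGraph V) (M : Fin n → SimpleGraph V),
      Subcubic G ∧ (∃ v, deg G v < 3) ∧ ¬ ThreeEC G ∧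
      Function.Injective M ∧ (∀ i, MinConfl G (M i)) ∧
      (∀ N : SimpleGraph V, MinConfl G N → ∃ i, N = M i) ∧
      (∀ i : ℕ, (h : i + 1 < n) →
        ((M ⟨i, by omega⟩).edgeSet ∩ (M ⟨i + 1, h⟩).edgeSet).Nonempty) := by
  refine ⟨Fin (n + 1) × Fin 9, inferInstance, chainG n, fun i => ringM n i.val, chain_deg n,
    ⟨_, chain_deg_lt n⟩, ?_, ?_, ?_, ?_, ?_⟩
  · exact fun h => ringM_not n 0 hn (threeEC_mono h (ringM_le n 0))
  · intro i j h
    exact Fin.ext (ringM_index i.2 (le_of_eq h))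
  · intro i
    refine ⟨ringM_le n i, ringM_not n i i.2, fun e he => ?_⟩
    have hle : (ringM n i).deleteEdges {e} ≤ ringM n i := SimpleGraph.deleteEdges_le _
    refine chain_colour n _ (hle.trans (ringM_le n i)) fun k hk h => ?_
    have := ringM_index hk (h.trans hle)
    subst this
    have := SimpleGraph.edgeSet_mono h he
    simp at this
  · rintro N ⟨hN, hnot, hmin⟩
    by_contra hcon
    push Not at hcon
    refine hnot (chain_colour n N hN fun k hk h => ?_)
    obtain ⟨e, heN, heM⟩ : ∃ e ∈ N.edgeSet, e ∉ (ringM n k).edgeSet := by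
      by_contra hall
      push Not at hall
      exact hcon ⟨k, hk⟩ (le_antisymm (SimpleGraph.edgeSet_subset_edgeSet.1 hall) h)
    refine ringM_not n k hk (threeEC_mono (hmin e heN) ?_)
    rw [← SimpleGraph.edgeSet_subset_edgeSet, SimpleGraph.edgeSet_deleteEdges]
    intro x hx
    exact ⟨SimpleGraph.edgeSet_mono h hx, fun hxe => heM (hxe ▸ hx)⟩
  · intro i h
    refine ⟨s((⟨i + 1, by omega⟩, 0), (⟨i + 1, by omega⟩, 1)), ?_, ?_⟩
    · exact Or.inl ⟨rfl, Or.inl ⟨(by decide : QE 0 1), Or.inr rfl⟩⟩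
    · exact Or.inl ⟨rfl, Or.inl ⟨(by decide : QE 0 1), Or.inl rfl⟩⟩
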